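/- Suppose (f, g) satisfies the SDP recursive equation, and set κ = 3 − 6·g(−1)² − f(0). Then κ ≥ 0. Moreover, as t ↓ 0: if κ = 0 then F(t) = 1 − g(−1)^{2/3}·t^{4/3} + o(t^{4/3}), while if κ > 0 then F(t) = 1 − (κ/2)^{1/3}·t^{2/3} + o(t^{2/3}). -/

import Mathlib

open Complex Asymptotics Filter Topology

/-- The characteristic function `t ↦ ∑ p(x) e^{itx}` of a function `p` on the integers. -/
noncomputable def intFourier (p : ℤ → ℝ) (t : ℝ) : ℂ :=
  ∑' x : ℤ, (p x : ℂ) * cexp (I * (t : ℂ) * (x : ℂ))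

lemma norm_cexp_I_mul_int (t : ℝ) (x : ℤ) : ‖cexp (I * (t : ℂ) * (x : ℂ))‖ = 1 := by
  have h : I * (t : ℂ) * (x : ℂ) = ((t * x : ℝ) : ℂ) * I := by push_cast; ring
  rw [h, norm_exp_ofReal_mul_I]

lemma summable_norm_intFourier {p : ℤ → ℝ} (hp : Summable p) (t : ℝ) :
    Summable fun x : ℤ => ‖(p x : ℂ) * cexp (I * (t : ℂ) * (x : ℂ))‖ := by
  simpa [norm_mul, norm_cexp_I_mul_int] using hp.abs

lemma hasSum_intFourier {p : ℤ → ℝ} (hp : Summable p) (t : ℝ) :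
    HasSum (fun x : ℤ => (p x : ℂ) * cexp (I * (t : ℂ) * (x : ℂ))) (intFourier p t) :=
  (summable_norm_intFourier hp t).of_norm.hasSum

lemma hasSum_intFourier_comp_add {p : ℤ → ℝ} (hp : Summable p) (t : ℝ) (k : ℤ) :
    HasSum (fun x : ℤ => (p (x + k) : ℂ) * cexp (I * (t : ℂ) * (x : ℂ)))
      (cexp (-(I * (t : ℂ) * (k : ℂ))) * intFourier p t) := by
  have h := ((Equiv.addRight k).hasSum_iff.2 (hasSum_intFourier hp t)).mul_left
    (cexp (-(I * (t : ℂ) * (k : ℂ))))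
  refine HasSum.congr_fun h ?_
  intro x
  simp only [Function.comp, Equiv.coe_addRight]
  rw [mul_left_comm, ← Complex.exp_add]
  congr 2
  push_cast; ring

lemma intFourier_conv {p q : ℤ → ℝ} (hp : Summable p) (hq : Summable q) (t : ℝ) :
    HasSum (fun y : ℤ => ((∑' j : ℤ, p j * q (y - j) : ℝ) : ℂ) * cexp (I * (t : ℂ) * (y : ℂ)))
      (intFourier p t * intFourier q t) := by
  have hp' := summable_norm_intFourier hp t
  have hq' := summable_norm_intFourier hq t
  have h := (summable_mul_of_summable_norm hp' hq').hasSum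
  rw [← tsum_mul_tsum_of_summable_norm hp' hq'] at h
  let e : ℤ × ℤ ≃ ℤ × ℤ :=
    { toFun := fun z => (z.2, z.1 - z.2)
      invFun := fun z => (z.1 + z.2, z.1)
      left_inv := fun z => by ext <;> simp
      right_inv := fun z => by ext <;> simp }
  have h2 := e.hasSum_iff.2 h
  have h3 : ∀ y : ℤ, Summable fun j : ℤ => ((p j * q (y - j) : ℝ) : ℂ) := by
    intro y
    refine Complex.summable_ofReal.2 ?_
    have hb : Summable fun z : ℤ × ℤ => p (e z).1 * q (e z).2 :=
      (e.summable_iff (f := fun z : ℤ × ℤ => p z.1 * q z.2)).2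
        (summable_mul_of_summable_norm hp.norm hq.norm)
    exact hb.prod_factor y
  refine h2.prod_fiberwise fun y => ?_
  rw [Complex.ofReal_tsum]
  refine ((h3 y).hasSum.mul_right (cexp (I * (t : ℂ) * (y : ℂ)))).congr_fun ?_
  intro j
  simp only [Function.comp, e, Equiv.coe_fn_mk]
  rw [mul_mul_mul_comm, ← Complex.exp_add]
  push_cast
  congr 2
  ring

lemma conj_intFourier (p : ℤ → ℝ) (t : ℝ) :
    (starRingEnd ℂ) (intFourier p t) = intFourier (fun x => p (-x)) t := by
  unfold intFourier
  rw [Complex.conj_tsum, ← (Equiv.neg ℤ).tsum_eq]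
  refine tsum_congr fun x => ?_
  simp [← Complex.exp_conj]

lemma intFourier_zero {p : ℤ → ℝ} {s : ℝ} (hp : HasSum p s) : intFourier p 0 = s := by
  simp [intFourier, ← Complex.ofReal_tsum, hp.tsum_eq]

lemma continuous_intFourier {p : ℤ → ℝ} (hp : Summable p) : Continuous (intFourier p) := by
  refine continuous_tsum (u := fun x => |p x|) (fun x => by fun_prop) hp.abs fun x t => ?_
  simp [norm_cexp_I_mul_int]

lemma norm_intFourier_le {p : ℤ → ℝ} {s : ℝ} (h0 : ∀ x, 0 ≤ p x) (hp : HasSum p s) (t : ℝ) :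
    ‖intFourier p t‖ ≤ s := by
  refine (norm_tsum_le_tsum_norm (summable_norm_intFourier hp.summable t)).trans (le_of_eq ?_)
  simp [norm_cexp_I_mul_int, abs_of_nonneg (h0 _), hp.tsum_eq]

/-- A root `z` of the quadratic `φ z² + (1 - 3φ) z + φ²` has real part `(3φ - 1) / (2φ)` whenever
its discriminant `(1 - φ)² (1 - 4φ)` is nonpositive. -/
lemma two_mul_re_of_quadratic {φ : ℝ} {z : ℂ} (hφ : 1 / 4 < φ)
    (h : φ * z ^ 2 + (1 - 3 * φ) * z + (φ : ℂ) ^ 2 = 0) : 2 * φ * z.re = 3 * φ - 1 := by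
  have hre := congrArg Complex.re h
  have him := congrArg Complex.im h
  simp [pow_two] at hre him
  rcases eq_or_ne z.im 0 with h0 | h0
  · rw [h0] at hre
    have : (2 * φ * z.re - (3 * φ - 1)) ^ 2 = (1 - φ) ^ 2 * (1 - 4 * φ) := by
      linear_combination 4 * φ * hre
    have h2 : (1 - φ) ^ 2 * (1 - 4 * φ) ≤ 0 :=
      mul_nonpos_of_nonneg_of_nonpos (sq_nonneg _) (by linarith)
    have h3 : 2 * φ * z.re - (3 * φ - 1) = 0 := by
      apply pow_eq_zero_iff (two_ne_zero) |>.1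
      nlinarith [sq_nonneg (2 * φ * z.re - (3 * φ - 1))]
    linarith
  · apply mul_left_cancel₀ h0
    linear_combination him

lemma tendsto_one_sub_cos_div_sq :
    Tendsto (fun t : ℝ => (1 - Real.cos t) / t ^ 2) (𝓝[>] 0) (𝓝 (1 / 2)) := by
  have h : Tendsto (fun t : ℝ => 1 / 2 * Real.sinc (t / 2) ^ 2) (𝓝[>] 0) (𝓝 (1 / 2)) := by
    have hc : Continuous fun t : ℝ => 1 / 2 * Real.sinc (t / 2) ^ 2 := by
      have := Real.continuous_sinc
      fun_prop
    simpa using (hc.tendsto 0).mono_left nhdsWithin_le_nhds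
  refine h.congr' ?_
  filter_upwards [self_mem_nhdsWithin] with t ht
  have ht : (0 : ℝ) < t := ht
  rw [Real.sinc_of_ne_zero (by positivity)]
  have h2 : Real.cos t = 1 - 2 * Real.sin (t / 2) ^ 2 := by
    have := Real.cos_sq' (t / 2)
    have h3 := Real.cos_two_mul (t / 2)
    rw [mul_div_cancel₀ t two_ne_zero] at h3
    linarith
  rw [h2]
  field_simp
  ring

/-- If `(1 - φ)³ / t^n → c` as `t ↓ 0` then `φ = 1 - c^{1/3} t^{n/3} + o(t^{n/3})`. -/
lemma isLittleO_of_tendsto_cube {φ : ℝ → ℝ} (hφ : ∀ t, φ t ≤ 1) {n : ℕ} {c : ℝ}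
    (h : Tendsto (fun t => (1 - φ t) ^ 3 / t ^ n) (𝓝[>] 0) (𝓝 c)) :
    (fun t : ℝ => φ t - (1 - c ^ ((1 : ℝ) / 3) * t ^ ((n : ℝ) / 3)))
      =o[𝓝[>] (0 : ℝ)] fun t : ℝ => t ^ ((n : ℝ) / 3) := by
  have hne : ∀ᶠ t : ℝ in 𝓝[>] 0, t ^ ((n : ℝ) / 3) ≠ 0 := by
    filter_upwards [self_mem_nhdsWithin] with t ht
    exact (Real.rpow_pos_of_pos ht _).ne'
  refine (isLittleO_iff_tendsto' (hne.mono fun t ht h0 => absurd h0 ht)).2 ?_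
  have h2 := h.rpow_const (p := (1 : ℝ) / 3) (Or.inr (by norm_num))
  have h3 := (tendsto_const_nhds (x := c ^ ((1 : ℝ) / 3))).sub h2
  rw [sub_self] at h3
  refine h3.congr' ?_
  filter_upwards [hne, self_mem_nhdsWithin] with t ht ht0
  have ht0 : (0 : ℝ) < t := ht0
  have hn : 0 ≤ 1 - φ t := by linarith [hφ t]
  rw [Real.div_rpow (by positivity) (by positivity), ← Real.rpow_natCast (1 - φ t) 3,
    ← Real.rpow_natCast t n, ← Real.rpow_mul hn, ← Real.rpow_mul ht0.le]
  norm_num [← div_eq_mul_one_div]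
  field_simp
  ring

section SDP

variable {f g : ℤ → ℝ}

lemma sdp_step_nonneg (hfsum : HasSum f 1)
    (hrec : ∀ x y : ℤ, -1 ≤ y →
      3 * f x * g y =
        f x * (f y + ∑ j ∈ Finset.Icc (-1 : ℤ) (y + 1), g j * g (y - j)) +
          (if y = -1 then
            (∑' j : ℕ, f (-(j : ℤ) - 2) * f (x + (j : ℤ) + 1)) +
              g (-1) ^ 2 * f (x + 1) + g (x - 1)
            else 0)) {y : ℤ} (hy : 0 ≤ y) :
    3 * g y = f y + ∑ j ∈ Finset.Icc (-1 : ℤ) (y + 1), g j * g (y - j) := by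
  obtain ⟨x, hx⟩ : ∃ x, f x ≠ 0 := by
    by_contra! h
    have h0 : f = fun _ => 0 := funext h
    rw [h0] at hfsum
    exact one_ne_zero (hfsum.unique hasSum_zero)
  have h := hrec x y (by lia)
  rw [if_neg (by lia)] at h
  apply mul_left_cancel₀ hx
  linarith

lemma tsum_conv_eq_sum_Icc (hgsupp : ∀ y : ℤ, y ≤ -2 → g y = 0) (y : ℤ) :
    ∑' j : ℤ, g j * g (y - j) = ∑ j ∈ Finset.Icc (-1 : ℤ) (y + 1), g j * g (y - j) := by
  refine tsum_eq_sum fun j hj => ?_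
  rw [Finset.mem_Icc, not_and_or] at hj
  rcases hj with hj | hj
  · rw [hgsupp j (by lia), zero_mul]
  · rw [hgsupp (y - j) (by lia), mul_zero]

lemma hasSum_intFourier_single (c : ℝ) (k : ℤ) (t : ℝ) :
    HasSum (fun y : ℤ => ((if y = k then c else 0 : ℝ) : ℂ) * cexp (I * (t : ℂ) * (y : ℂ)))
      ((c : ℂ) * cexp (I * (t : ℂ) * (k : ℂ))) := by
  have h := hasSum_single (f := fun y : ℤ =>
    ((if y = k then c else 0 : ℝ) : ℂ) * cexp (I * (t : ℂ) * (y : ℂ))) k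
    (fun y hy => by simp [hy])
  simpa using h

/-- The transform of the recursion over steps `y ≥ 0`. -/
lemma sdp_fourier_step (hfsum : HasSum f 1) (hgsum : HasSum g 1)
    (hgsupp : ∀ y : ℤ, y ≤ -2 → g y = 0)
    (hstep : ∀ y : ℤ, 0 ≤ y →
      3 * g y = f y + ∑ j ∈ Finset.Icc (-1 : ℤ) (y + 1), g j * g (y - j)) (t : ℝ) :
    3 * intFourier g t - intFourier (Set.indicator (Set.Ici 0) f) t - intFourier g t ^ 2 =
      ((3 * g (-1) - 2 * g (-1) * g 0 : ℝ) : ℂ) * cexp (I * (t : ℂ) * ((-1 : ℤ) : ℂ))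
        - ((g (-1) ^ 2 : ℝ) : ℂ) * cexp (I * (t : ℂ) * ((-2 : ℤ) : ℂ)) := by
  have h1 := (((hasSum_intFourier hgsum.summable t).mul_left 3).sub
    (hasSum_intFourier (hfsum.summable.indicator (Set.Ici 0)) t)).sub
    (intFourier_conv hgsum.summable hgsum.summable t)
  have h2 := (hasSum_intFourier_single (3 * g (-1) - 2 * g (-1) * g 0) (-1) t).sub
    (hasSum_intFourier_single (g (-1) ^ 2) (-2) t)
  rw [pow_two]
  refine h1.unique (h2.congr_fun ?_)
  intro y
  rw [tsum_conv_eq_sum_Icc hgsupp]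
  have key : 3 * g y - Set.indicator (Set.Ici 0) f y
      - ∑ j ∈ Finset.Icc (-1 : ℤ) (y + 1), g j * g (y - j) =
      (if y = -1 then 3 * g (-1) - 2 * g (-1) * g 0 else 0)
        - (if y = -2 then g (-1) ^ 2 else 0) := by
    rcases le_or_gt 0 y with hy | hy
    · rw [if_neg (by lia), if_neg (by lia), Set.indicator_of_mem (by exact hy), hstep y hy]
      ring
    · rw [Set.indicator_of_notMem (by simpa using hy)]
      rcases eq_or_ne y (-1) with rfl | h1
      · have : Finset.Icc (-1 : ℤ) (-1 + 1) = {-1, 0} := by decide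
        rw [this]
        simp
        ring
      rcases eq_or_ne y (-2) with rfl | h2
      · have : Finset.Icc (-1 : ℤ) (-2 + 1) = {-1} := by decide
        rw [this]
        simp [hgsupp (-2) le_rfl]
        ring
      · rw [if_neg h1, if_neg h2, Finset.Icc_eq_empty (by lia), hgsupp y (by lia)]
        simp
  have key' := congrArg (fun r : ℝ => (r : ℂ)) key
  simp only [Complex.ofReal_sub, Complex.ofReal_mul, Complex.ofReal_ofNat] at key' ⊢
  linear_combination cexp (I * (t : ℂ) * (y : ℂ)) * key'

lemma tsum_nat_eq_conv_indicator (x : ℤ) :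
    ∑' j : ℕ, f (-(j : ℤ) - 2) * f (x + (j : ℤ) + 1) =
      ∑' m : ℤ, Set.indicator (Set.Iic (-2)) f m * f (x - 1 - m) := by
  have hi : Function.Injective fun j : ℕ => -(j : ℤ) - 2 := by
    intro a b h
    simp only at h
    lia
  rw [← hi.tsum_eq]
  · refine tsum_congr fun j => ?_
    rw [Set.indicator_of_mem (by simp)]
    congr 2
    ring
  · intro m hm
    have hm2 : m ≤ -2 := by
      by_contra hc
      refine hm ?_
      simp only
      rw [Set.indicator_of_notMem (by simpa using hc), zero_mul]
    exact ⟨(-2 - m).toNat, by simp only; lia⟩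

/-- The transform of the recursion at the step `y = -1`. -/
lemma sdp_fourier_position (hfsum : HasSum f 1) (hgsum : HasSum g 1)
    (hrec : ∀ x y : ℤ, -1 ≤ y →
      3 * f x * g y =
        f x * (f y + ∑ j ∈ Finset.Icc (-1 : ℤ) (y + 1), g j * g (y - j)) +
          (if y = -1 then
            (∑' j : ℕ, f (-(j : ℤ) - 2) * f (x + (j : ℤ) + 1)) +
              g (-1) ^ 2 * f (x + 1) + g (x - 1)
            else 0)) (t : ℝ) :
    (((3 * g (-1) - 2 * g (-1) * g 0 : ℝ) : ℂ) * cexp (I * (t : ℂ) * ((-1 : ℤ) : ℂ))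
        - ((g (-1) ^ 2 : ℝ) : ℂ) * cexp (I * (t : ℂ) * ((-2 : ℤ) : ℂ))) * intFourier f t =
      (intFourier f t - intFourier (Set.indicator (Set.Ici 0) f) t) * intFourier f t
        + intFourier g t := by
  have hs := hfsum.summable
  have h1 := (hasSum_intFourier_comp_add hs t 1).mul_left
    ((3 * g (-1) - 2 * g (-1) * g 0 - f (-1) : ℝ) : ℂ)
  have h2 := ((intFourier_conv (hs.indicator (Set.Iic (-2))) hs t).add
    ((hasSum_intFourier_comp_add hs t 2).mul_left ((g (-1) ^ 2 : ℝ) : ℂ))).add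
    (hasSum_intFourier hgsum.summable t)
  have h12 := h1.unique (h2.congr_fun (fun x => by
    have h := hrec (x + 1) (-1) le_rfl
    have hI : Finset.Icc (-1 : ℤ) (-1 + 1) = {-1, 0} := by decide
    rw [if_pos rfl, tsum_nat_eq_conv_indicator, hI] at h
    simp only [add_sub_cancel_right, add_assoc] at h
    norm_num at h
    have h' := congrArg (fun r : ℝ => (r : ℂ)) h
    push_cast at h' ⊢
    linear_combination cexp (I * (t : ℂ) * (x : ℂ)) * h'))
  have h3 := (hasSum_intFourier hs t).unique
    ((((hasSum_intFourier (hs.indicator (Set.Ici 0)) t).add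
      (hasSum_intFourier (hs.indicator (Set.Iic (-2))) t)).add
      (hasSum_intFourier_single (f (-1)) (-1) t)).congr_fun (fun x => by
        rcases le_or_gt 0 x with hx | hx
        · rw [Set.indicator_of_mem (by exact hx),
            Set.indicator_of_notMem (by simp; lia), if_neg (by lia)]
          simp
        rw [Set.indicator_of_notMem (by simpa using hx)]
        rcases eq_or_ne x (-1) with rfl | hx1
        · simp
        · rw [Set.indicator_of_mem (by simp; lia), if_neg hx1]
          simp))
  have e1 : -(I * (t : ℂ) * ((1 : ℤ) : ℂ)) = I * (t : ℂ) * ((-1 : ℤ) : ℂ) := by push_cast; ring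
  have e2 : -(I * (t : ℂ) * ((2 : ℤ) : ℂ)) = I * (t : ℂ) * ((-2 : ℤ) : ℂ) := by push_cast; ring
  rw [e1, e2] at h12
  push_cast at h12 h3 ⊢
  linear_combination h12 - intFourier f t * h3

lemma two_mul_re_intFourier_indicator (hfsum : HasSum f 1) (hfsymm : ∀ x, f (-x) = f x) (t : ℝ) :
    2 * (intFourier (Set.indicator (Set.Ici 0) f) t).re = (intFourier f t).re + f 0 := by
  have hs := hfsum.summable
  have hs' := hs.indicator (Set.Ici (0 : ℤ))
  have h := ((hasSum_intFourier hs' t).add (hasSum_intFourier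
    (p := fun x => Set.indicator (Set.Ici 0) f (-x)) ((Equiv.neg ℤ).summable_iff.2 hs') t)).unique
    (((hasSum_intFourier hs t).add (hasSum_intFourier_single (f 0) 0 t)).congr_fun (fun x => by
      rw [← add_mul, ← add_mul, ← Complex.ofReal_add, ← Complex.ofReal_add]
      congr 2
      simp only [Set.indicator, Set.mem_Ici, hfsymm]
      rcases lt_trichotomy x 0 with hx | rfl | hx
      · rw [if_neg (by lia), if_pos (by lia), if_neg (by lia)]; ring
      · simp
      · rw [if_pos (by lia), if_neg (by lia), if_neg (by lia)]))
  rw [← conj_intFourier] at h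
  have h' := congrArg Complex.re h
  simp at h'
  linarith

end SDP

/-- Suppose `(f, g)` satisfies the SDP recursive equation, and set
`κ = 3 - 6 g(-1)² - f 0`.  Then `κ ≥ 0`, and as `t ↓ 0`:
if `κ = 0` then `F(t) = 1 - g(-1)^{2/3} t^{4/3} + o(t^{4/3})`, while
if `κ > 0` then `F(t) = 1 - (κ/2)^{1/3} t^{2/3} + o(t^{2/3})`. -/
theorem stmt_13
    (f g : ℤ → ℝ)
    (hf0 : ∀ x, 0 ≤ f x) (hg0 : ∀ y, 0 ≤ g y)
    (hfsum : HasSum f 1) (hgsum : HasSum g 1)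
    (hfsymm : ∀ x, f (-x) = f x)
    (hgsupp : ∀ y : ℤ, y ≤ -2 → g y = 0)
    (hrec : ∀ x y : ℤ, -1 ≤ y →
      3 * f x * g y =
        f x * (f y + ∑ j ∈ Finset.Icc (-1 : ℤ) (y + 1), g j * g (y - j)) +
          (if y = -1 then
            (∑' j : ℕ, f (-(j : ℤ) - 2) * f (x + (j : ℤ) + 1)) +
              g (-1) ^ 2 * f (x + 1) + g (x - 1)
            else 0))
    (F : ℝ → ℂ)
    (hF : ∀ t : ℝ, F t = ∑' x : ℤ, (f x : ℂ) * Complex.exp (Complex.I * (t : ℂ) * (x : ℂ)))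
    (κ : ℝ) (hκ : κ = 3 - 6 * g (-1) ^ 2 - f 0) :
    0 ≤ κ ∧
    (κ = 0 →
      (fun t : ℝ => F t - ((1 - g (-1) ^ ((2 : ℝ) / 3) * t ^ ((4 : ℝ) / 3) : ℝ) : ℂ))
        =o[𝓝[>] (0 : ℝ)] fun t : ℝ => t ^ ((4 : ℝ) / 3)) ∧
    (0 < κ →
      (fun t : ℝ => F t - ((1 - (κ / 2) ^ ((1 : ℝ) / 3) * t ^ ((2 : ℝ) / 3) : ℝ) : ℂ))
        =o[𝓝[>] (0 : ℝ)] fun t : ℝ => t ^ ((2 : ℝ) / 3)) := by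
  set φ : ℝ → ℝ := fun t => (intFourier f t).re with hφ
  have hFφ : ∀ t, intFourier f t = (φ t : ℂ) := fun t => by
    refine (Complex.conj_eq_iff_re.1 ?_).symm
    rw [conj_intFourier]
    simp only [hfsymm]
  have hφ1 : ∀ t, φ t ≤ 1 := fun t =>
    (Complex.re_le_norm _).trans (norm_intFourier_le hf0 hfsum t)
  have hφc : Continuous φ := Complex.continuous_re.comp (continuous_intFourier hfsum.summable)
  have hφ0 : φ 0 = 1 := by simp [hφ, intFourier_zero hfsum]
  have hφlim : Tendsto φ (𝓝[>] 0) (𝓝 1) := by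
    simpa [hφ0] using (hφc.tendsto 0).mono_left nhdsWithin_le_nhds
  set a := g (-1) with ha
  set D := 3 * a - 2 * a * g 0 with hD
  have hS := sdp_fourier_step hfsum hgsum hgsupp (fun y => sdp_step_nonneg hfsum hrec)
  have hP := sdp_fourier_position hfsum hgsum hrec
  have hR := two_mul_re_intFourier_indicator hfsum hfsymm
  have hSre : ∀ t, 3 * (intFourier g t).re - (intFourier (Set.indicator (Set.Ici 0) f) t).re
      - (intFourier g t ^ 2).re = D * Real.cos t - a ^ 2 * Real.cos (2 * t) := fun t => by
    have h := congrArg Complex.re (hS t)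
    have e1 : I * (t : ℂ) * ((-1 : ℤ) : ℂ) = ((-t : ℝ) : ℂ) * I := by push_cast; ring
    have e2 : I * (t : ℂ) * ((-2 : ℤ) : ℂ) = ((-(2 * t) : ℝ) : ℂ) * I := by push_cast; ring
    rw [e1, e2] at h
    simpa only [Complex.sub_re, Complex.re_ofReal_mul, Complex.exp_ofReal_mul_I_re, Real.cos_neg,
      Complex.mul_re, Complex.re_ofNat, Complex.im_ofNat,
      Complex.ofReal_re, Complex.ofReal_im, zero_mul, sub_zero] using h
  have hD0 : D = 3 / 2 + a ^ 2 - f 0 / 2 := by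
    have h := hSre 0
    have h' := hR 0
    rw [intFourier_zero hgsum] at h
    rw [intFourier_zero hfsum] at h'
    simp at h h'
    linarith
  have hcube : ∀ t, 1 / 4 < φ t → (1 - φ t) ^ 3 =
      2 * φ t ^ 2 * (1 - Real.cos t) * (κ / 2 + 2 * a ^ 2 * (1 - Real.cos t)) := fun t ht => by
    have h1 := hS t
    have h2 := hP t
    rw [hFφ] at h2
    have hq : φ t * intFourier g t ^ 2 + (1 - 3 * φ t) * intFourier g t + (φ t : ℂ) ^ 2 = 0 := by
      linear_combination -(φ t : ℂ) * h1 - h2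
    have hre := two_mul_re_of_quadratic ht hq
    have hqre := congrArg Complex.re hq
    have e : φ t * intFourier g t ^ 2 + (1 - 3 * φ t) * intFourier g t + (φ t : ℂ) ^ 2 =
      (φ t : ℂ) * intFourier g t ^ 2 + ((1 - 3 * φ t : ℝ) : ℂ) * intFourier g t
        + ((φ t ^ 2 : ℝ) : ℂ) := by push_cast; ring
    rw [e] at hqre
    simp only [Complex.add_re, Complex.re_ofReal_mul, Complex.ofReal_re, Complex.zero_re] at hqre
    have h3 := hSre t
    have h4 : 2 * (intFourier (Set.indicator (Set.Ici 0) f) t).re = φ t + f 0 := hR t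
    rw [Real.cos_two_mul] at h3
    rw [hκ]
    rw [hD0] at h3
    linear_combination (-2 * φ t) * hqre + (-2 * φ t ^ 2) * h3 - φ t ^ 2 * h4 + hre
  have hev : ∀ᶠ t in 𝓝[>] (0 : ℝ), 1 / 4 < φ t := hφlim.eventually_const_lt (by norm_num)
  have hcos := tendsto_one_sub_cos_div_sq
  have hcos0 : Tendsto (fun t : ℝ => 1 - Real.cos t) (𝓝[>] 0) (𝓝 0) := by
    have hc : Continuous fun t : ℝ => 1 - Real.cos t := by fun_prop
    simpa using (hc.tendsto 0).mono_left nhdsWithin_le_nhds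
  have hlim : Tendsto (fun t => (1 - φ t) ^ 3 / t ^ 2) (𝓝[>] 0) (𝓝 (κ / 2)) := by
    have h := (((hφlim.pow 2).const_mul 2).mul hcos).mul
      ((hcos0.const_mul (2 * a ^ 2)).const_add (κ / 2))
    have e : 2 * (1 : ℝ) ^ 2 * (1 / 2) * (κ / 2 + 2 * a ^ 2 * 0) = κ / 2 := by ring
    rw [e] at h
    refine h.congr' ?_
    filter_upwards [hev] with t ht
    rw [hcube t ht]
    ring
  have hF' : ∀ t, F t = (φ t : ℂ) := fun t => by rw [hF, ← hFφ]; rfl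
  refine ⟨?_, fun hκ0 => ?_, fun _ => ?_⟩
  · have h : 0 ≤ κ / 2 := by
      refine ge_of_tendsto' hlim fun t => ?_
      have := hφ1 t
      have : 0 ≤ 1 - φ t := by linarith
      positivity
    linarith
  · have hlim4 : Tendsto (fun t => (1 - φ t) ^ 3 / t ^ 4) (𝓝[>] 0) (𝓝 (a ^ 2)) := by
      have h := (((hφlim.pow 2).const_mul (4 * a ^ 2)).mul hcos).mul hcos
      have e : 4 * a ^ 2 * (1 : ℝ) ^ 2 * (1 / 2) * (1 / 2) = a ^ 2 := by ring
      rw [e] at h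
      refine h.congr' ?_
      filter_upwards [hev] with t ht
      rw [hcube t ht, hκ0]
      ring
    have h := isLittleO_of_tendsto_cube hφ1 hlim4
    have e : (a ^ 2) ^ ((1 : ℝ) / 3) = a ^ ((2 : ℝ) / 3) := by
      rw [← Real.rpow_natCast a 2, ← Real.rpow_mul (show 0 ≤ a from hg0 _)]
      norm_num
    rw [e] at h
    refine IsLittleO.of_norm_left (h.norm_left.congr_left fun t => ?_)
    rw [hF', ← Complex.ofReal_sub, Complex.norm_real]
    norm_num
  · have h := isLittleO_of_tendsto_cube hφ1 hlim
    refine IsLittleO.of_norm_left (h.norm_left.congr_left fun t => ?_)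
    rw [hF', ← Complex.ofReal_sub, Complex.norm_real]
    norm_num
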